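/- (Corollary 1, PTW-KT) Let n ≥ 1, d = ⌈log₂ n⌉, and x_{1:n} ∈ {0,1}^n. Let μ be a piecewise stationary source with partition P ∈ 𝒯_n whose i-th segment source is i.i.d. Bernoulli(θ_i) with θ_i ∈ [0,1] for 1 ≤ i ≤ |P| (so μ^i(y_{1:m}) = θ_i^{b}(1−θ_i)^{a} where a and b are the numbers of zeros and ones in y_{1:m}). If μ(x_{1:n}) > 0, then the redundancy of PTW with the KT estimator as base model satisfies: there exists a refinement P′ ∈ 𝒞_d of P with Γ_d(P′) ≤ 2·|P|·(⌈log₂ n⌉ + 1) such that log₂ μ(x_{1:n}) − log₂ PTW_d(x_{1:n}) ≤ Γ_d(P′) + (|P|/2)·log₂⌈ n / (|P|·(⌈log₂ n⌉ + 1)) ⌉·(⌈log₂ n⌉ + 1) + |P|·(⌈log₂ n⌉ + 1). -/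

import Mathlib

/-- The set `𝒞_d(t)` of binary temporal partitions starting at `t`, represented as
finsets of segments `(a,b)` (each segment identified with the interval `{a,…,b}`). -/
def Cpt : ℕ → ℕ → Finset (Finset (ℕ × ℕ))
  | 0, t => {{(t, t)}}
  | d + 1, t =>
      insert {(t, t + 2 ^ (d + 1) - 1)}
        ((Cpt d t ×ˢ Cpt d (t + 2 ^ d)).image fun p => p.1 ∪ p.2)

/-- `Γ_d(P)`: the number of nodes of depth less than `d` in the binary partition tree
associated with `P ∈ 𝒞_d(t)`, defined by the recursion `Γ_0(P) = 0`,
`Γ_{d+1}({(t, t+2^{d+1}-1)}) = 1` and `Γ_{d+1}(S₁ ∪ S₂) = Γ_d(S₁) + Γ_d(S₂) + 1`. -/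
def Gam : ℕ → ℕ → Finset (ℕ × ℕ) → ℕ
  | 0, _, _ => 0
  | d + 1, t, P =>
      if P = {(t, t + 2 ^ (d + 1) - 1)} then 1
      else Gam d t (P.filter fun s => s.2 < t + 2 ^ d)
            + Gam d (t + 2 ^ d) (P.filter fun s => t + 2 ^ d ≤ s.1) + 1

/-- The substring `x_{a:min(b,n)}` of the (1-based) sequence `x` of length `n`,
treated as a standalone string; it is the empty string when `a > min(b,n)`. -/
def seg {𝒳 : Type*} (x : ℕ → 𝒳) (n a b : ℕ) : List 𝒳 :=
  (List.range (min b n + 1 - a)).map fun i => x (a + i)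

/-- `ρ` is a probabilistic data generating source: `ρ(ε) = 1`,
`ρ(x_{1:n}) = ∑_{y ∈ 𝒳} ρ(x_{1:n} y)`, and all values lie in `[0,1]`. -/
def IsSource {𝒳 : Type*} [Fintype 𝒳] (ρ : List 𝒳 → ℝ) : Prop :=
  ρ [] = 1 ∧ (∀ l : List 𝒳, ρ l = ∑ y : 𝒳, ρ (l ++ [y])) ∧
    ∀ l : List 𝒳, ρ l ∈ Set.Icc (0 : ℝ) 1

/-- The Partition Tree Weighting mixture
`PTW_d(x_{1:n}) = ∑_{P ∈ 𝒞_d} 2^{-Γ_d(P)} ∏_{(a,b) ∈ P} ρ(x_{a:b})` (for `n ≤ 2^d`). -/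
noncomputable def PTW {𝒳 : Type*} (ρ : List 𝒳 → ℝ) (d : ℕ) (x : ℕ → 𝒳) (n : ℕ) : ℝ :=
  ∑ P ∈ Cpt d 1, (2 : ℝ) ^ (-(Gam d 1 P : ℤ)) * ∏ s ∈ P, ρ (seg x n s.1 s.2)

/-- The Krichevsky–Trofimov estimator: for a binary string with `b` ones and `a`
zeros, `KT(x_{1:m}) = ∫₀¹ θ^b (1-θ)^a · π⁻¹ θ^{-1/2} (1-θ)^{-1/2} dθ`. -/
noncomputable def KT (l : List Bool) : ℝ :=
  ∫ θ in (0 : ℝ)..1,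
    θ ^ l.count true * (1 - θ) ^ l.count false *
      (Real.pi⁻¹ * θ ^ (-(1 / 2) : ℝ) * (1 - θ) ^ (-(1 / 2) : ℝ))

/-- `P` is a temporal partition of `{1,…,n}`: a set of pairwise non-overlapping
segments `(a,b)` with `a ≤ b`, whose union is exactly `{1,…,n}`. -/
def IsTPartition (n : ℕ) (P : Finset (ℕ × ℕ)) : Prop :=
  (∀ s ∈ P, s.1 ≤ s.2) ∧
  (∀ s ∈ P, ∀ t ∈ P, s ≠ t → ∀ i, s.1 ≤ i → i ≤ s.2 → ¬(t.1 ≤ i ∧ i ≤ t.2)) ∧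
  (∀ i : ℕ, (1 ≤ i ∧ i ≤ n) ↔ ∃ s ∈ P, s.1 ≤ i ∧ i ≤ s.2)

/-- `C(P)`: the set of change points of `P`, i.e. the left endpoints of its segments
other than `1`. A partition `P'` is a refinement of `P` if `C(P) ⊆ C(P')`. -/
def changePts (P : Finset (ℕ × ℕ)) : Finset ℕ :=
  (P.image Prod.fst).erase 1

noncomputable def ktc (a b : ℕ) : ℝ :=
  Real.pi⁻¹ * (Real.Gamma (b + 1/2) * Real.Gamma (a + 1/2) / Real.Gamma (a + b + 1))

lemma KT_eq (l : List Bool) : KT l = ktc (l.count false) (l.count true) := by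
  set a := l.count false with ha
  set b := l.count true with hb
  have hb0 : (0:ℝ) < b + 1/2 := by positivity
  have ha0 : (0:ℝ) < a + 1/2 := by positivity
  have h := ProbabilityTheory.beta_eq_betaIntegralReal (b + 1/2) (a + 1/2) hb0 ha0
  have h2 : Complex.betaIntegral ((b + 1/2 : ℝ) : ℂ) ((a + 1/2 : ℝ) : ℂ)
      = ((∫ t in (0:ℝ)..1, t ^ ((b:ℝ) + 1/2 - 1) * (1 - t) ^ ((a:ℝ) + 1/2 - 1) : ℝ) : ℂ) := by
    rw [Complex.betaIntegral, ← intervalIntegral.integral_ofReal]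
    apply intervalIntegral.integral_congr
    intro t ht
    rw [Set.uIcc_of_le zero_le_one] at ht
    simp only
    push_cast
    rw [Complex.ofReal_cpow ht.1, Complex.ofReal_cpow (by linarith [ht.2])]
    push_cast
    rfl
  rw [h2, Complex.ofReal_re] at h
  have h3 : KT l = Real.pi⁻¹ * ∫ t in (0:ℝ)..1, t ^ ((b:ℝ) + 1/2 - 1) * (1 - t) ^ ((a:ℝ) + 1/2 - 1) := by
    rw [KT, ← intervalIntegral.integral_const_mul]
    apply intervalIntegral.integral_congr
    intro t ht
    rw [Set.uIcc_of_le zero_le_one] at ht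
    simp only
    have key : ∀ k : ℕ, ∀ y : ℝ, 0 ≤ y → y ^ ((k:ℝ) + 1/2 - 1) = y ^ (-(1/2) : ℝ) * y ^ k := by
      intro k y hy
      rw [← Real.rpow_add_natCast' hy]
      · congr 1; ring
      · intro h0
        have : (2 * k : ℝ) = 1 := by linarith
        have : 2 * k = 1 := by exact_mod_cast this
        omega
    rw [key _ _ ht.1, key _ _ (by linarith [ht.2]), ← ha, ← hb]
    ring
  rw [h3, ← h, ktc, ProbabilityTheory.beta]
  congr 3
  ring

lemma ktc_pos (a b : ℕ) : 0 < ktc a b := by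
  unfold ktc
  have h1 := Real.Gamma_pos_of_pos (show (0:ℝ) < b + 1/2 by positivity)
  have h2 := Real.Gamma_pos_of_pos (show (0:ℝ) < a + 1/2 by positivity)
  have h3 := Real.Gamma_pos_of_pos (show (0:ℝ) < a + b + 1 by positivity)
  have := Real.pi_pos
  positivity

lemma ktc_zero : ktc 0 0 = 1 := by
  have := Real.pi_pos
  simp only [ktc, Nat.cast_zero, zero_add, Real.Gamma_one_half_eq, Real.Gamma_one, div_one]
  rw [Real.mul_self_sqrt this.le, inv_mul_cancel₀ this.ne']

lemma ktc_symm (a b : ℕ) : ktc a b = ktc b a := by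
  unfold ktc
  rw [mul_comm (Real.Gamma _), add_comm (a:ℝ) b]

lemma ktc_succ (a b : ℕ) : ktc (a+1) b = ktc a b * ((a + 1/2) / (a + b + 1)) := by
  unfold ktc
  have h1 : Real.Gamma (((a+1 : ℕ) : ℝ) + 1/2) = (a + 1/2) * Real.Gamma (a + 1/2) := by
    rw [← Real.Gamma_add_one (by positivity)]; congr 1; push_cast; ring
  have h2 : Real.Gamma (((a+1 : ℕ) : ℝ) + b + 1) = (a + b + 1) * Real.Gamma (a + b + 1) := by
    rw [← Real.Gamma_add_one (by positivity)]; congr 1; push_cast; ring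
  rw [h1, h2]
  have h3 := Real.Gamma_pos_of_pos (show (0:ℝ) < a + b + 1 by positivity)
  field_simp

lemma log_ineq1 (m : ℝ) (hm : 0 < m) : 1 ≤ (m + 1/2) * (Real.log (m+1) - Real.log m) := by
  have h := Real.le_log_one_add_of_nonneg (x := 1/m) (by positivity)
  rw [← Real.log_div (by positivity) hm.ne']
  have e : 1 + 1/m = (m+1)/m := by field_simp
  rw [e] at h
  have e2 : 2 * (1/m) / (1/m + 2) = 1 / (m + 1/2) := by field_simp; ring
  rw [e2] at h
  calc (1:ℝ) = (m + 1/2) * (1/(m+1/2)) := by field_simp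
    _ ≤ _ := by gcongr

lemma psi_nonneg (w : ℝ) (h0 : 0 ≤ w) (h1 : w < 1) :
    (1+w) * Real.log (1+w) - (1-w) * Real.log (1-w) ≤ 2 * w := by
  have hd : ∀ t ∈ Set.Ico (0:ℝ) 1, HasDerivAt
      (fun w : ℝ => 2 * w - (1+w) * Real.log (1+w) + (1-w) * Real.log (1-w))
      (2 - (Real.log (1+t) + 1) - (Real.log (1-t) + 1)) t := by
    intro t ht
    have a1 := (Real.hasDerivAt_mul_log (x := 1+t) (by linarith [ht.1])).comp t
      ((hasDerivAt_id t).const_add 1)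
    have a2 := (Real.hasDerivAt_mul_log (x := 1-t) (by linarith [ht.2])).comp t
      ((hasDerivAt_id t).const_sub 1)
    have a3 := (((hasDerivAt_id t).const_mul 2).sub a1).add a2
    convert! a3 using 1
    ring
  have hm : MonotoneOn (fun w : ℝ => 2 * w - (1+w) * Real.log (1+w) + (1-w) * Real.log (1-w))
      (Set.Ico 0 1) := by
    apply monotoneOn_of_deriv_nonneg (convex_Ico 0 1)
    · intro t ht
      exact (hd t ht).continuousAt.continuousWithinAt
    · intro t ht
      rw [interior_Ico] at ht
      exact (hd t ⟨ht.1.le, ht.2⟩).differentiableAt.differentiableWithinAt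
    · intro t ht
      rw [interior_Ico] at ht
      rw [(hd t ⟨ht.1.le, ht.2⟩).deriv]
      have : Real.log (1+t) + Real.log (1-t) ≤ 0 := by
        rw [← Real.log_mul (by linarith [ht.1]) (by linarith [ht.2])]
        apply Real.log_nonpos
        · nlinarith [ht.1, ht.2]
        · nlinarith [ht.1, ht.2]
      linarith
  have := hm (a := 0) (b := w) ⟨le_rfl, zero_lt_one⟩ ⟨h0, h1⟩ h0
  simp at this
  linarith

lemma log_ineq2 (a : ℕ) :
    ((a:ℝ)+1) * Real.log (a+1) - a * Real.log a - Real.log (a + 1/2) ≤ 1 := by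
  rcases Nat.eq_zero_or_pos a with rfl | ha
  · simp
    have := Real.log_two_lt_d9
    linarith
  have ha' : (0:ℝ) < a := by exact_mod_cast ha
  have h := psi_nonneg (1/(2*a+1)) (by positivity) (by
    rw [div_lt_one (by positivity)]; linarith)
  have e1 : 1 + 1/(2*(a:ℝ)+1) = (a+1)/(a+1/2) := by field_simp; ring
  have e2 : 1 - 1/(2*(a:ℝ)+1) = a/(a+1/2) := by field_simp; ring
  rw [e1, e2, Real.log_div (by positivity) (by positivity),
    Real.log_div (by positivity) (by positivity)] at h
  have h' := mul_le_mul_of_nonneg_left h (show (0:ℝ) ≤ a + 1/2 by positivity)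
  have e3 : ((a:ℝ)+1/2) * (2 * (1/(2*(a:ℝ)+1))) = 1 := by field_simp
  rw [e3] at h'
  refine le_trans (le_of_eq ?_) h'
  field_simp
  ring

noncomputable def ktL (a b : ℕ) : ℝ :=
  Real.log (ktc a b) + 1/2 * Real.log (a+b) + (a+b) * Real.log (a+b)
    - a * Real.log a - b * Real.log b

lemma ktL_symm (a b : ℕ) : ktL a b = ktL b a := by
  unfold ktL
  rw [ktc_symm, add_comm (a:ℝ) b]; ring

lemma ktL_step (a b : ℕ) (h : 1 ≤ a + b) : ktL a b ≤ ktL (a+1) b := by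
  have hm : (0:ℝ) < a + b := by exact_mod_cast h
  have h1 := log_ineq1 (a+b) hm
  have h2 := log_ineq2 a
  unfold ktL
  rw [ktc_succ, Real.log_mul (ktc_pos a b).ne' (by positivity),
    Real.log_div (by positivity) (by positivity)]
  push_cast
  have e : (a:ℝ) + 1 + b = a + b + 1 := by ring
  rw [e]
  nlinarith

lemma ktL_base : ktL 1 0 = - Real.log 2 := by
  have := ktc_succ 0 0
  simp [ktc_zero] at this
  simp [ktL, this]

lemma ktL_pos_left (a b : ℕ) : - Real.log 2 ≤ ktL (a+1) b := by
  induction b with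
  | zero =>
    induction a with
    | zero => rw [ktL_base]
    | succ k ih => exact ih.trans (ktL_step _ _ (by omega))
  | succ k ih =>
    refine ih.trans ?_
    rw [ktL_symm, ktL_symm (a+1)]
    exact ktL_step _ _ (by omega)

lemma ktL_lower (a b : ℕ) (h : 1 ≤ a + b) : - Real.log 2 ≤ ktL a b := by
  rcases a with _ | a
  · rcases b with _ | b
    · omega
    · rw [ktL_symm]; exact ktL_pos_left _ _
  · exact ktL_pos_left _ _

lemma gibbs_aux (b : ℕ) (m τ : ℝ) (hm : 0 < m) (hτ : 0 ≤ τ) (h : b ≠ 0 → 0 < τ) :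
    b * Real.log τ ≤ b * Real.log b - b * Real.log m + (τ * m - b) := by
  rcases Nat.eq_zero_or_pos b with rfl | hb
  · simp; positivity
  have hτ' := h hb.ne'
  have hb' : (0:ℝ) < b := by exact_mod_cast hb
  have := Real.log_le_sub_one_of_pos (show 0 < τ * m / b by positivity)
  rw [Real.log_div (by positivity) (by positivity), Real.log_mul (by positivity) (by positivity)] at this
  have h' := mul_le_mul_of_nonneg_left this hb'.le
  have e : (b:ℝ) * (τ * m / b - 1) = τ * m - b := by field_simp
  rw [e] at h'
  linarith

lemma kt_bound (l : List Bool) (τ c : ℝ) (hτ0 : 0 ≤ τ) (hτ1 : τ ≤ 1) (hc : 1 ≤ c)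
    (ht : l.count true ≠ 0 → 0 < τ) (hf : l.count false ≠ 0 → 0 < 1 - τ) :
    l.count true * Real.log τ + l.count false * Real.log (1 - τ) ≤
      Real.log (KT l) + (1/2 * Real.log c + Real.log 2 - 1/2) + l.length / c / 2 := by
  have hlen : l.count true + l.count false = l.length := by
    simp
  rw [KT_eq]
  set a := l.count false
  set b := l.count true
  have hl2 : (1/2:ℝ) < Real.log 2 := by linarith [Real.log_two_gt_d9]
  have hlc := Real.log_nonneg hc
  rw [← hlen]
  push_cast
  by_cases h : 1 ≤ a + b
  · have hm : (0:ℝ) < a + b := by exact_mod_cast h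
    have g1 := gibbs_aux b (a+b) τ hm hτ0 ht
    have g2 := gibbs_aux a (a+b) (1-τ) hm (by linarith) hf
    have g3 := ktL_lower a b h
    unfold ktL at g3
    have g4 := Real.log_le_sub_one_of_pos (show 0 < ((a:ℝ)+b)/c by positivity)
    rw [Real.log_div (by positivity) (by positivity)] at g4
    have e : ((b:ℝ) + a)/c = (a+b)/c := by rw [add_comm]
    rw [e]
    nlinarith
  · have ha : a = 0 := by omega
    have hb : b = 0 := by omega
    simp [ha, hb, ktc_zero]
    linarith

lemma seg_sum (x : ℕ → Bool) (n a b : ℕ) (p q : ℝ) :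
    ∑ i ∈ Finset.Icc a b, (if i ≤ n then (if x i = true then p else q) else 0)
      = (seg x n a b).count true * p + (seg x n a b).count false * q := by
  rw [← Finset.sum_filter]
  have e : (Finset.Icc a b).filter (fun i => i ≤ n) = Finset.Ico a (min b n + 1) := by
    ext i; simp only [Finset.mem_filter, Finset.mem_Icc, Finset.mem_Ico]; omega
  rw [e, Finset.sum_Ico_eq_sum_range, seg]
  generalize min b n + 1 - a = k
  induction k with
  | zero => simp
  | succ k ih =>
    rw [Finset.sum_range_succ, ih, List.range_succ]
    cases h : x (a + k) <;> simp [h] <;> ring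

lemma seg_length (x : ℕ → Bool) (n a b : ℕ) : (seg x n a b).length = min b n + 1 - a := by
  simp [seg]

lemma mem_seg_count (x : ℕ → Bool) (n a b : ℕ) (v : Bool) (h : (seg x n a b).count v ≠ 0) :
    ∃ i, a ≤ i ∧ i ≤ b ∧ i ≤ n ∧ x i = v := by
  have := List.count_pos_iff.1 (Nat.pos_of_ne_zero h)
  simp only [seg, List.mem_map, List.mem_range] at this
  obtain ⟨j, hj, hx⟩ := this
  exact ⟨a + j, by omega, by omega, by omega, hx⟩

lemma seg_count_pos (x : ℕ → Bool) (n a b i : ℕ) (h1 : a ≤ i) (h2 : i ≤ b) (h3 : i ≤ n) :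
    (seg x n a b).count (x i) ≠ 0 := by
  apply Nat.pos_iff_ne_zero.1
  apply List.count_pos_iff.2
  simp only [seg, List.mem_map, List.mem_range]
  exact ⟨i - a, by omega, by congr 1; omega⟩

lemma exists_tree (C : Finset ℕ) (d : ℕ) : ∀ t : ℕ, ∃ P' ∈ Cpt d t,
    (∀ s ∈ P', t ≤ s.1 ∧ s.1 ≤ s.2 ∧ s.2 < t + 2 ^ d) ∧
    (∃ s ∈ P', s.1 = t) ∧
    (∀ c ∈ C, t < c → c < t + 2 ^ d → ∃ s ∈ P', s.1 = c) ∧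
    (∀ s ∈ P', ∀ c ∈ C, ¬ (s.1 < c ∧ c ≤ s.2)) ∧
    Gam d t P' ≤ 2 * d * (C.filter fun c => t < c ∧ c < t + 2 ^ d).card + 1 ∧
    P'.card ≤ d * (C.filter fun c => t < c ∧ c < t + 2 ^ d).card + 1 ∧
    (∀ G : ℕ → ℝ, ∑ s ∈ P', ∑ i ∈ Finset.Icc s.1 s.2, G i = ∑ i ∈ Finset.Ico t (t + 2 ^ d), G i) := by
  induction d with
  | zero =>
    intro t
    refine ⟨{(t, t)}, by simp [Cpt], by simp, by simp, ?_, ?_, by simp [Gam], by simp, by simp⟩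
    · intro c _ h1 h2; simp at h2; omega
    · simp
  | succ d ih =>
    intro t
    have hpow : 2 ^ (d+1) = 2 ^ d + 2 ^ d := by rw [pow_succ]; ring
    have hpos : 0 < 2 ^ d := by positivity
    by_cases hK : (C.filter fun c => t < c ∧ c < t + 2 ^ (d+1)) = ∅
    · have hK' : ∀ c ∈ C, ¬ (t < c ∧ c < t + 2 ^ (d+1)) := by
        intro c hc h
        have : c ∈ (C.filter fun c => t < c ∧ c < t + 2 ^ (d+1)) := by simp [hc, h]
        rw [hK] at this
        simp at this
      refine ⟨{(t, t + 2 ^ (d+1) - 1)}, by simp [Cpt], ?_, by simp, ?_, ?_, ?_, ?_, ?_⟩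
      · intro s hs
        rw [Finset.mem_singleton] at hs
        subst hs
        simp only
        omega
      · intro c hc h1 h2
        exact absurd ⟨h1, h2⟩ (hK' c hc)
      · intro s hs c hc h
        rw [Finset.mem_singleton] at hs
        subst hs
        simp only at h
        exact hK' c hc (by omega)
      · simp [Gam]
      · simp
      · intro G
        rw [Finset.sum_singleton]
        apply Finset.sum_congr _ (fun _ _ => rfl)
        ext i
        simp only [Finset.mem_Icc, Finset.mem_Ico]
        omega
    · obtain ⟨S1, hS1, a1, b1, c1, d1, e1, f1, g1⟩ := ih t
      obtain ⟨S2, hS2, a2, b2, c2, d2, e2, f2, g2⟩ := ih (t + 2 ^ d)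
      have hdisj : Disjoint S1 S2 := by
        rw [Finset.disjoint_left]
        intro s h1 h2
        have := a1 s h1
        have := a2 s h2
        omega
      have hKpos : 1 ≤ (C.filter fun c => t < c ∧ c < t + 2 ^ (d+1)).card :=
        Finset.card_pos.2 (Finset.nonempty_iff_ne_empty.2 hK)
      have hKle : (C.filter fun c => t < c ∧ c < t + 2 ^ d).card
          + (C.filter fun c => t + 2 ^ d < c ∧ c < t + 2 ^ d + 2 ^ d).card
          ≤ (C.filter fun c => t < c ∧ c < t + 2 ^ (d+1)).card := by
        rw [← Finset.card_union_of_disjoint]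
        · apply Finset.card_le_card
          intro c
          simp only [Finset.mem_union, Finset.mem_filter]
          rintro (⟨h, h1, h2⟩ | ⟨h, h1, h2⟩) <;> refine ⟨h, ?_, ?_⟩ <;> omega
        · rw [Finset.disjoint_left]
          intro c
          simp only [Finset.mem_filter]
          intro h1 h2
          omega
      have hfil1 : (S1 ∪ S2).filter (fun s => s.2 < t + 2 ^ d) = S1 := by
        ext s
        simp only [Finset.mem_filter, Finset.mem_union]
        constructor
        · rintro ⟨h | h, h'⟩
          · exact h
          · have := a2 s h; omega
        · intro h; exact ⟨Or.inl h, (a1 s h).2.2⟩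
      have hfil2 : (S1 ∪ S2).filter (fun s => t + 2 ^ d ≤ s.1) = S2 := by
        ext s
        simp only [Finset.mem_filter, Finset.mem_union]
        constructor
        · rintro ⟨h | h, h'⟩
          · have := a1 s h; omega
          · exact h
        · intro h; exact ⟨Or.inr h, (a2 s h).1⟩
      have hne : S1 ∪ S2 ≠ {(t, t + 2 ^ (d+1) - 1)} := by
        intro h
        obtain ⟨s, hs, hst⟩ := b2
        have : s ∈ S1 ∪ S2 := Finset.mem_union_right _ hs
        rw [h, Finset.mem_singleton] at this
        subst this
        simp only at hst
        omega
      set K := (C.filter fun c => t < c ∧ c < t + 2 ^ (d+1)).card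
      set K1 := (C.filter fun c => t < c ∧ c < t + 2 ^ d).card
      set K2 := (C.filter fun c => t + 2 ^ d < c ∧ c < t + 2 ^ d + 2 ^ d).card
      have hdK : d * K1 + d * K2 ≤ d * K := by
        rw [← mul_add]; exact Nat.mul_le_mul_left _ hKle
      refine ⟨S1 ∪ S2, ?_, ?_, ?_, ?_, ?_, ?_, ?_, ?_⟩
      · rw [Cpt]
        apply Finset.mem_insert_of_mem
        rw [Finset.mem_image]
        exact ⟨(S1, S2), Finset.mem_product.2 ⟨hS1, hS2⟩, rfl⟩
      · intro s hs
        rcases Finset.mem_union.1 hs with h | h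
        · have := a1 s h; omega
        · have := a2 s h; omega
      · obtain ⟨s, hs, hst⟩ := b1
        exact ⟨s, Finset.mem_union_left _ hs, hst⟩
      · intro c hc h1 h2
        rcases lt_trichotomy c (t + 2 ^ d) with h | h | h
        · obtain ⟨s, hs, hst⟩ := c1 c hc h1 h
          exact ⟨s, Finset.mem_union_left _ hs, hst⟩
        · obtain ⟨s, hs, hst⟩ := b2
          exact ⟨s, Finset.mem_union_right _ hs, by omega⟩
        · obtain ⟨s, hs, hst⟩ := c2 c hc h (by omega)
          exact ⟨s, Finset.mem_union_right _ hs, hst⟩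
      · intro s hs
        rcases Finset.mem_union.1 hs with h | h
        · exact d1 s h
        · exact d2 s h
      · rw [Gam, if_neg hne, hfil1, hfil2]
        nlinarith
      · rw [Finset.card_union_of_disjoint hdisj]
        nlinarith
      · intro G
        rw [Finset.sum_union hdisj, g1, g2, hpow, ← add_assoc]
        exact Finset.sum_Ico_consecutive G (by omega) (by omega)

lemma tpart_sum (n : ℕ) (P : Finset (ℕ × ℕ)) (hP : IsTPartition n P) (G : ℕ → ℝ) :
    ∑ s ∈ P, ∑ i ∈ Finset.Icc s.1 s.2, G i = ∑ i ∈ Finset.Icc 1 n, G i := by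
  obtain ⟨_, h2, h3⟩ := hP
  rw [← Finset.sum_biUnion]
  · apply Finset.sum_congr _ (fun _ _ => rfl)
    ext i
    simp only [Finset.mem_biUnion, Finset.mem_Icc]
    exact (h3 i).symm
  · intro s hs t ht hst
    rw [Function.onFun, Finset.disjoint_left]
    intro i hi hi'
    rw [Finset.mem_Icc] at hi hi'
    exact h2 s hs t ht hst i hi.1 hi.2 hi'

lemma KT_pos (l : List Bool) : 0 < KT l := by
  rw [KT_eq]; exact ktc_pos _ _

/-- **Corollary 1, PTW-KT.** Let `n ≥ 1`, `d = ⌈log₂ n⌉` and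
`x_{1:n} ∈ {0,1}ⁿ`.  Let `μ` be a piecewise stationary source with partition
`P ∈ 𝒯_n` whose segment `(a,b) ∈ P` is i.i.d. `Bernoulli(θ_{(a,b)})` with
`θ_{(a,b)} ∈ [0,1]`, so `μ(x_{1:n}) = ∏_{(a,b) ∈ P} θ^{#ones}(1-θ)^{#zeros}`.
If `μ(x_{1:n}) > 0`, then there exists a refinement `P' ∈ 𝒞_d` of `P` with
`Γ_d(P') ≤ 2·|P|·(⌈log₂ n⌉ + 1)` such that
`log₂ μ(x_{1:n}) - log₂ PTW_d(x_{1:n}) ≤ Γ_d(P')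
  + (|P|/2)·log₂⌈n / (|P|·(⌈log₂ n⌉ + 1))⌉·(⌈log₂ n⌉ + 1) + |P|·(⌈log₂ n⌉ + 1)`,
where the base model of PTW is the KT estimator. -/
theorem ptw_kt_redundancy (n : ℕ) (hn : 1 ≤ n) (x : ℕ → Bool)
    (P : Finset (ℕ × ℕ)) (hP : IsTPartition n P)
    (θ : ℕ × ℕ → ℝ) (hθ : ∀ s ∈ P, θ s ∈ Set.Icc (0 : ℝ) 1)
    (hμpos : 0 < ∏ s ∈ P, θ s ^ (seg x n s.1 s.2).count true
        * (1 - θ s) ^ (seg x n s.1 s.2).count false) :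
    ∃ P' ∈ Cpt (Nat.clog 2 n) 1,
      changePts P ⊆ changePts P' ∧
      Gam (Nat.clog 2 n) 1 P' ≤ 2 * P.card * (Nat.clog 2 n + 1) ∧
      Real.logb 2 (∏ s ∈ P, θ s ^ (seg x n s.1 s.2).count true
            * (1 - θ s) ^ (seg x n s.1 s.2).count false)
          - Real.logb 2 (PTW KT (Nat.clog 2 n) x n)
        ≤ (Gam (Nat.clog 2 n) 1 P' : ℝ)
            + (P.card : ℝ) / 2
              * Real.logb 2 (((n + P.card * (Nat.clog 2 n + 1) - 1)
                  / (P.card * (Nat.clog 2 n + 1)) : ℕ) : ℝ)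
              * (Nat.clog 2 n + 1)
            + (P.card : ℝ) * (Nat.clog 2 n + 1) := by
  classical
  set d := Nat.clog 2 n with hd
  have hnd : n ≤ 2 ^ d := Nat.le_pow_clog (by norm_num) n
  obtain ⟨P', hP'mem, ha, hb, hc, hdd, he, hf, hg⟩ := exists_tree (changePts P) d 1
  obtain ⟨p1, p2, p3⟩ := id hP
  have hPc : 1 ≤ P.card := by
    obtain ⟨s, hs, _⟩ := (p3 1).1 ⟨le_rfl, hn⟩
    exact Finset.card_pos.2 ⟨s, hs⟩
  set K := ((changePts P).filter fun c => 1 < c ∧ c < 1 + 2 ^ d).card with hKdef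
  have hKle : K ≤ P.card := by
    refine (Finset.card_filter_le _ _).trans ?_
    refine (Finset.card_erase_le).trans Finset.card_image_le
  have hdK : d * K ≤ d * P.card := Nat.mul_le_mul_left _ hKle
  have hseg : ∀ s ∈ P, 1 ≤ s.1 ∧ s.2 ≤ n := by
    intro s hs
    have h1 := (p3 s.1).2 ⟨s, hs, le_rfl, p1 s hs⟩
    have h2 := (p3 s.2).2 ⟨s, hs, p1 s hs, le_rfl⟩
    exact ⟨h1.1, h2.2⟩
  refine ⟨P', hP'mem, ?_, by nlinarith, ?_⟩
  · intro c hcC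
    have hcC' := hcC
    simp only [changePts, Finset.mem_erase, Finset.mem_image] at hcC'
    obtain ⟨hc1, s, hs, rfl⟩ := hcC'
    have h1 := hseg s hs
    have h2 := p1 s hs
    obtain ⟨s', hs', hss⟩ := hc s.1 hcC (by omega) (by omega)
    simp only [changePts, Finset.mem_erase, Finset.mem_image]
    exact ⟨hc1, s', hs', hss⟩
  have hex : ∀ i : ℕ, ∃ r : ℕ × ℕ, (1 ≤ i ∧ i ≤ n) → (r ∈ P ∧ r.1 ≤ i ∧ i ≤ r.2) := by
    intro i
    by_cases h : 1 ≤ i ∧ i ≤ n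
    · obtain ⟨s, hs, h'⟩ := (p3 i).1 h
      exact ⟨s, fun _ => ⟨hs, h'⟩⟩
    · exact ⟨(0,0), fun h' => absurd h' h⟩
  choose r hr using hex
  have hruniq : ∀ s ∈ P, ∀ i, s.1 ≤ i → i ≤ s.2 → r i = s := by
    intro s hs i h1 h2
    by_contra hne
    have h := hr i (by have := hseg s hs; omega)
    exact p2 s hs (r i) h.1 (fun h => hne h.symm) i h1 h2 h.2
  set G : ℕ → ℝ := fun i => if i ≤ n then
    (if x i = true then Real.log (θ (r i)) else Real.log (1 - θ (r i))) else 0 with hG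
  have hGseg : ∀ (s q : ℕ × ℕ), (∀ i, s.1 ≤ i → i ≤ s.2 → i ≤ n → r i = q) →
      ∑ i ∈ Finset.Icc s.1 s.2, G i = (seg x n s.1 s.2).count true * Real.log (θ q)
        + (seg x n s.1 s.2).count false * Real.log (1 - θ q) := by
    intro s q h
    rw [← seg_sum]
    apply Finset.sum_congr rfl
    intro i hi
    rw [Finset.mem_Icc] at hi
    by_cases hin : i ≤ n
    · simp only [hG, hin, if_true, h i hi.1 hi.2 hin]
    · simp only [hG, hin, if_false]
  have hne : ∀ s ∈ P, θ s ^ (seg x n s.1 s.2).count true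
        * (1 - θ s) ^ (seg x n s.1 s.2).count false ≠ 0 := by
    intro s hs
    exact (Finset.prod_ne_zero_iff.1 hμpos.ne') s hs
  have hpt : ∀ s ∈ P, (seg x n s.1 s.2).count true ≠ 0 → 0 < θ s := by
    intro s hs h
    refine lt_of_le_of_ne (hθ s hs).1 fun h0 => hne s hs ?_
    rw [← h0, zero_pow h, zero_mul]
  have hpf : ∀ s ∈ P, (seg x n s.1 s.2).count false ≠ 0 → 0 < 1 - θ s := by
    intro s hs h
    refine lt_of_le_of_ne (by linarith [(hθ s hs).2]) fun h0 => hne s hs ?_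
    rw [← h0, zero_pow h, mul_zero]
  have hlogμ : Real.log (∏ s ∈ P, θ s ^ (seg x n s.1 s.2).count true
            * (1 - θ s) ^ (seg x n s.1 s.2).count false) = ∑ i ∈ Finset.Icc 1 n, G i := by
    rw [Real.log_prod hne, ← tpart_sum n P hP]
    apply Finset.sum_congr rfl
    intro s hs
    rw [hGseg s s (fun i h1 h2 _ => hruniq s hs i h1 h2)]
    have := hne s hs
    rw [Real.log_mul (left_ne_zero_of_mul this) (right_ne_zero_of_mul this),
      Real.log_pow, Real.log_pow]
  have hleaf : ∀ H : ℕ → ℝ, (∀ i, n < i → H i = 0) →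
      ∑ s ∈ P', ∑ i ∈ Finset.Icc s.1 s.2, H i = ∑ i ∈ Finset.Icc 1 n, H i := by
    intro H hH
    rw [hg]
    symm
    apply Finset.sum_subset
    · intro i
      simp only [Finset.mem_Icc, Finset.mem_Ico]
      omega
    · intro i hi hi'
      simp only [Finset.mem_Icc, Finset.mem_Ico] at hi hi'
      exact hH i (by omega)
  have hlen : ∑ s ∈ P', ((seg x n s.1 s.2).length : ℝ) = n := by
    have h := hleaf (fun i => if i ≤ n then (if x i = true then (1:ℝ) else 1) else 0)
      (by intro i hi; simp; omega)
    simp only [seg_sum] at h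
    have h2 : ∑ i ∈ Finset.Icc 1 n, (if i ≤ n then (if x i = true then (1:ℝ) else 1) else 0) = n := by
      rw [Finset.sum_congr rfl (g := fun _ => (1:ℝ))]
      · simp
      · intro i hi
        rw [Finset.mem_Icc] at hi
        simp [hi.2]
    rw [seg_sum] at h2; rw [h2] at h
    rw [← h]
    apply Finset.sum_congr rfl
    intro s _
    rw [← List.count_true_add_count_false (seg x n s.1 s.2)]
    push_cast
    ring
  set M : ℕ := P.card * (d + 1) with hM
  have hMpos : 1 ≤ M := by nlinarith
  set c : ℕ := (n + M - 1) / M with hcdef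
  have hnc : n ≤ M * c := by
    have h1 := Nat.div_add_mod (n + M - 1) M
    have h2 := Nat.mod_lt (n + M - 1) (show 0 < M by omega)
    rw [← hcdef] at h1
    omega
  have hc1 : 1 ≤ c := by
    rcases Nat.eq_zero_or_pos c with h | h
    · rw [h] at hnc; omega
    · exact h
  have hc1' : (1:ℝ) ≤ c := by exact_mod_cast hc1
  have hcard : P'.card ≤ M := by nlinarith
  have hbound : ∀ s ∈ P', ∑ i ∈ Finset.Icc s.1 s.2, G i ≤ Real.log (KT (seg x n s.1 s.2))
      + (1/2 * Real.log c + Real.log 2 - 1/2) + (seg x n s.1 s.2).length / c / 2 := by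
    intro s hs
    have hs1 := ha s hs
    by_cases hsn : s.1 ≤ n
    · obtain ⟨hqP, hq1, hq2⟩ := hr s.1 ⟨hs1.1, hsn⟩
      set q := r s.1 with hq
      have hin : ∀ i, s.1 ≤ i → i ≤ s.2 → i ≤ n → i ≤ q.2 := by
        intro i h1 h2 h3
        by_contra hlt
        obtain ⟨u, hu, hu1, hu2⟩ := (p3 (q.2 + 1)).1 ⟨by omega, by omega⟩
        have huq : u ≠ q := by
          intro h; rw [h] at hu2; omega
        have hu3 : u.1 = q.2 + 1 := by
          by_contra h
          exact p2 u hu q hqP huq q.2 (by omega) (by omega) ⟨by omega, le_rfl⟩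
        refine hdd s hs u.1 ?_ ⟨by omega, by omega⟩
        simp only [changePts, Finset.mem_erase, Finset.mem_image]
        exact ⟨by omega, u, hu, rfl⟩
      rw [hGseg s q (fun i h1 h2 h3 => hruniq q hqP i (by omega) (hin i h1 h2 h3))]
      apply kt_bound _ _ _ (hθ q hqP).1 (hθ q hqP).2 hc1'
      · intro h
        obtain ⟨i, h1, h2, h3, h4⟩ := mem_seg_count _ _ _ _ _ h
        apply hpt q hqP
        rw [← h4]
        exact seg_count_pos x n q.1 q.2 i (by omega) (hin i h1 h2 h3) h3
      · intro h
        obtain ⟨i, h1, h2, h3, h4⟩ := mem_seg_count _ _ _ _ _ h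
        apply hpf q hqP
        rw [← h4]
        exact seg_count_pos x n q.1 q.2 i (by omega) (hin i h1 h2 h3) h3
    · have h0 : seg x n s.1 s.2 = [] := by
        rw [← List.length_eq_zero_iff, seg_length]; omega
      have hz : ∑ i ∈ Finset.Icc s.1 s.2, G i = 0 := by
        apply Finset.sum_eq_zero
        intro i hi
        rw [Finset.mem_Icc] at hi
        simp only [hG]
        rw [if_neg (by omega)]
      have := kt_bound (seg x n s.1 s.2) (1/2) c (by norm_num) (by norm_num) hc1'
        (by norm_num) (by norm_num)
      rw [hz]
      simpa [h0] using this
  have hl2 : (1/2:ℝ) < Real.log 2 := by linarith [Real.log_two_gt_d9]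
  have hlc := Real.log_nonneg hc1'
  have hmain : ∑ i ∈ Finset.Icc 1 n, G i ≤ ∑ s ∈ P', Real.log (KT (seg x n s.1 s.2))
      + M * (1/2 * Real.log c + Real.log 2) := by
    have h1 : ∑ i ∈ Finset.Icc 1 n, G i = ∑ s ∈ P', ∑ i ∈ Finset.Icc s.1 s.2, G i := by
      rw [hleaf]
      intro i hi
      simp only [hG]
      rw [if_neg (by omega)]
    rw [h1]
    refine (Finset.sum_le_sum hbound).trans ?_
    rw [Finset.sum_add_distrib, Finset.sum_add_distrib, ← Finset.sum_div, ← Finset.sum_div, hlen,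
      Finset.sum_const, nsmul_eq_mul]
    have h2 : (n:ℝ) / c ≤ M := by
      rw [div_le_iff₀ (by linarith)]
      exact_mod_cast hnc
    have h3 : (P'.card : ℝ) ≤ M := by exact_mod_cast hcard
    have h4 : (P'.card : ℝ) * (1/2 * Real.log c + Real.log 2 - 1/2)
        ≤ M * (1/2 * Real.log c + Real.log 2 - 1/2) :=
      mul_le_mul_of_nonneg_right h3 (by linarith)
    linarith
  have hprodpos : 0 < ∏ s ∈ P', KT (seg x n s.1 s.2) :=
    Finset.prod_pos fun s _ => KT_pos _
  have hPTW : (2:ℝ) ^ (-(Gam d 1 P' : ℤ)) * ∏ s ∈ P', KT (seg x n s.1 s.2) ≤ PTW KT d x n := by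
    rw [PTW]
    apply Finset.single_le_sum
      (f := fun Q => (2:ℝ) ^ (-(Gam d 1 Q : ℤ)) * ∏ s ∈ Q, KT (seg x n s.1 s.2)) _ hP'mem
    intro Q _
    have : 0 < ∏ s ∈ Q, KT (seg x n s.1 s.2) := Finset.prod_pos fun s _ => KT_pos _
    positivity
  have hlogPTW : -(Gam d 1 P' : ℝ) * Real.log 2 + ∑ s ∈ P', Real.log (KT (seg x n s.1 s.2))
      ≤ Real.log (PTW KT d x n) := by
    refine le_trans (le_of_eq ?_) (Real.log_le_log (by positivity) hPTW)
    rw [Real.log_mul (by positivity) hprodpos.ne', Real.log_zpow,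
      Real.log_prod (fun s _ => (KT_pos _).ne')]
    push_cast
    ring
  have hl2pos : 0 < Real.log 2 := by linarith
  simp only [Real.logb]
  rw [hlogμ, ← sub_div, div_le_iff₀ hl2pos]
  have hMr : (M:ℝ) = P.card * (d + 1) := by rw [hM]; push_cast; ring
  have e : ((Gam d 1 P' : ℝ) + (P.card : ℝ) / 2 * (Real.log c / Real.log 2) * (d + 1)
      + (P.card : ℝ) * (d + 1)) * Real.log 2
      = Gam d 1 P' * Real.log 2 + M * (1/2 * Real.log c + Real.log 2) := by
    rw [hMr]; field_simp; ring
  rw [e]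
  linarith
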